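/- Let N, M ≥ 1, let S be a finite type with probability mass function p, let χ : S → ℝ with E[χ] ≠ 0, let G ≥ 0 be a real number, and let σ_α² > 0, σ² > 0 with σ_α²·Var(χ) + σ²·G > 0, where E[χ] = Σ_t p(t)χ(t) and Var(χ) = E[χ²] − E[χ]². Define MSE = N·M·( σ_α²·E[(χ − 1)²] + σ²·G ) and DR = N·M·σ_α²·E[χ]² / ( σ_α²·Var(χ) + σ²·G ). Then MSE / ( σ_α²·E[χ]² ) = N²·M² / DR + N·M·( (E[χ] − 1)/E[χ] )². -/

import Mathlib

open scoped BigOperators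

/-- The second moment about `1` expanded in terms of the raw moments of a weight of total mass `1`. -/
theorem sum_mul_sub_one_sq {S : Type*} [Fintype S] (p χ : S → ℝ) (hp : ∑ t, p t = 1) :
    ∑ t, p t * (χ t - 1) ^ 2 = (∑ t, p t * χ t ^ 2) - 2 * (∑ t, p t * χ t) + 1 := by
  have h : ∀ t, p t * (χ t - 1) ^ 2 = p t * χ t ^ 2 - 2 * (p t * χ t) + p t := fun t => by ring
  simp only [h, Finset.sum_add_distrib, Finset.sum_sub_distrib, ← Finset.mul_sum, hp]

/-- Equation (44) of the paper: the normalized MSE equals N²M²/DR plus a penalty term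
proportional to ((E[χ]−1)/E[χ])². -/
theorem nmse_dr_decomposition
    (N M : ℕ) (hN : 0 < N) (hM : 0 < M)
    (S : Type*) [Fintype S]
    (p : S → ℝ) (hp0 : ∀ t, 0 ≤ p t) (hp1 : ∑ t, p t = 1)
    (χ : S → ℝ) (hEχ : (∑ t, p t * χ t) ≠ 0)
    (G : ℝ) (hG : 0 ≤ G)
    (σα2 σ2 : ℝ) (hσα2 : 0 < σα2) (hσ2 : 0 < σ2)
    (hpos : 0 < σα2 * ((∑ t, p t * χ t ^ 2) - (∑ t, p t * χ t) ^ 2) + σ2 * G)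
    (MSE DR : ℝ)
    (hMSE : MSE = (N : ℝ) * M * (σα2 * (∑ t, p t * (χ t - 1) ^ 2) + σ2 * G))
    (hDR : DR = (N : ℝ) * M * σα2 * (∑ t, p t * χ t) ^ 2 /
      (σα2 * ((∑ t, p t * χ t ^ 2) - (∑ t, p t * χ t) ^ 2) + σ2 * G)) :
    MSE / (σα2 * (∑ t, p t * χ t) ^ 2)
      = (N : ℝ) ^ 2 * (M : ℝ) ^ 2 / DR
        + (N : ℝ) * M * (((∑ t, p t * χ t) - 1) / (∑ t, p t * χ t)) ^ 2 := by
  have hN' : (N : ℝ) ≠ 0 := by positivity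
  have hM' : (M : ℝ) ≠ 0 := by positivity
  rw [hMSE, hDR, sum_mul_sub_one_sq p χ hp1]
  generalize (∑ t, p t * χ t) = m at *
  generalize (∑ t, p t * χ t ^ 2) = q at *
  have hD := hpos.ne'
  field_simp
  ring
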